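/- arXiv:2202.06207 — 4 statements merged into one kernel-verified Lean document; each statement's English description precedes it below -/
import Mathlib

section
/- Let M, N, L be positive integers with L ≥ M, let R_T be an M×M Hermitian positive definite complex matrix with eigenvalues λ_1,…,λ_M > 0 and eigendecomposition R_T = U_Tᴴ diag(λ_1,…,λ_M) U_T, and let p_s > 0. Then the supremum of (N/L) log₂ det(I_L + Sᴴ R_T S) over S ∈ ℂ^{M×L} with tr(S Sᴴ) ≤ p_s equals (N/L) ∑_{m=1}^{M} log₂(1 + λ_m a*_m), where a*_m = max{0, 1/ν − 1/λ_m} and ν > 0 is the unique value with ∑_{m=1}^{M} max{0, 1/ν − 1/λ_m} = p_s; the supremum is attained by any S with S Sᴴ = U_Tᴴ diag(a*_1,…,a*_M) U_T. Moreover, lim_{p_s→∞} [ this supremum − (NM/L)( log₂ p_s + (1/M) ∑_{m=1}^{M} log₂(λ_m/M) ) ] = 0. -/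
open Matrix Real ComplexOrder Filter

/-- The logarithm of the determinant of a positive definite matrix is at most the trace of the
matrix minus the identity. -/
theorem Matrix.PosDef.log_det_le_trace_sub_card {n : Type*} [Fintype n] [DecidableEq n]
    {A : Matrix n n ℂ} (hA : A.PosDef) :
    Real.log A.det.re ≤ A.trace.re - Fintype.card n := by
  have hdet : A.det.re = ∏ i, hA.isHermitian.eigenvalues i := by
    rw [hA.isHermitian.det_eq_prod_eigenvalues]
    norm_cast
  have htr : A.trace.re = ∑ i, hA.isHermitian.eigenvalues i := by
    rw [hA.isHermitian.trace_eq_sum_eigenvalues]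
    norm_cast
  rw [hdet, htr, Real.log_prod fun i _ => (hA.eigenvalues_pos i).ne']
  calc ∑ i, Real.log (hA.isHermitian.eigenvalues i)
      ≤ ∑ i, (hA.isHermitian.eigenvalues i - 1) :=
        Finset.sum_le_sum fun i _ => Real.log_le_sub_one_of_pos (hA.eigenvalues_pos i)
    _ = ∑ i, hA.isHermitian.eigenvalues i - Fintype.card n := by simp

/-- The tangent-plane bound for the concave function `Q ↦ log det (1 + Λ Q)` at a diagonal
point `diag a`, written for `Q = T Tᴴ`. -/
theorem log_det_one_add_le_tangent {m l : Type*} [Fintype m] [DecidableEq m] [Fintype l]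
    [DecidableEq l] (lam a : m → ℝ) (hlam : ∀ i, 0 < lam i) (ha : ∀ i, 0 ≤ a i)
    (T : Matrix m l ℂ) :
    Real.log (1 + Tᴴ * Matrix.diagonal (fun i => (lam i : ℂ)) * T).det.re ≤
      ∑ i, Real.log (1 + lam i * a i) +
        ∑ i, lam i * (((T * Tᴴ) i i).re - a i) / (1 + lam i * a i) := by
  have hb : ∀ i, 0 < 1 + lam i * a i := fun i => by
    have := mul_nonneg (hlam i).le (ha i)
    linarith
  set b : m → ℝ := fun i => 1 + lam i * a i
  set G : Matrix m m ℂ := Matrix.diagonal fun i => ((√(b i))⁻¹ : ℝ) with hG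
  set H : Matrix m m ℂ := Matrix.diagonal fun i => (√(lam i) : ℝ) with hH
  have hGH : Gᴴ = G := by simp [hG, Matrix.diagonal_conjTranspose, Pi.star_def]
  have hHH : Hᴴ = H := by simp [hH, Matrix.diagonal_conjTranspose, Pi.star_def]
  have hHsq : H * H = Matrix.diagonal fun i => (lam i : ℂ) := by
    rw [hH, Matrix.diagonal_mul_diagonal]
    congr 1
    ext i
    rw [← Complex.ofReal_mul, Real.mul_self_sqrt (hlam i).le]
  have hGsq : ∀ i, (√(b i))⁻¹ * (√(b i))⁻¹ = (b i)⁻¹ := fun i => by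
    rw [← mul_inv, Real.mul_self_sqrt (hb i).le]
  have hGdet : G.det * G.det = ((∏ i, b i)⁻¹ : ℝ) := by
    rw [hG, Matrix.det_diagonal, ← Finset.prod_mul_distrib, ← Finset.prod_inv_distrib,
      Complex.ofReal_prod]
    exact Finset.prod_congr rfl fun i _ => by rw [← Complex.ofReal_mul, hGsq]
  have hX : (1 + H * T * (H * T)ᴴ).PosDef :=
    Matrix.PosDef.one.add_posSemidef (Matrix.posSemidef_self_mul_conjTranspose _)
  have hdetX : (1 + H * T * (H * T)ᴴ).det =
      (1 + Tᴴ * Matrix.diagonal (fun i => (lam i : ℂ)) * T).det := by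
    rw [Matrix.det_one_add_mul_comm, Matrix.conjTranspose_mul, hHH, ← hHsq]
    simp only [Matrix.mul_assoc]
  have hGinj : Function.Injective G.mulVec := by
    refine Matrix.mulVec_injective_of_isUnit ?_
    rw [Matrix.isUnit_iff_isUnit_det, isUnit_iff_ne_zero]
    intro h
    rw [h, zero_mul] at hGdet
    have := Complex.ofReal_eq_zero.mp hGdet.symm
    exact (inv_pos.mpr (Finset.prod_pos fun i _ => hb i)).ne' this
  have hC : (G * (1 + H * T * (H * T)ᴴ) * G).PosDef := by
    have := hX.conjTranspose_mul_mul_same hGinj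
    rwa [hGH] at this
  have hCdet : (G * (1 + H * T * (H * T)ᴴ) * G).det.re =
      (∏ i, b i)⁻¹ * (1 + H * T * (H * T)ᴴ).det.re := by
    rw [Matrix.det_mul, Matrix.det_mul, mul_right_comm, hGdet, Complex.re_ofReal_mul]
  have hCdiag : ∀ i, ((G * (1 + H * T * (H * T)ᴴ) * G : Matrix m m ℂ) i i).re =
      1 + lam i * (((T * Tᴴ) i i).re - a i) / b i := fun i => by
    have hXi : (1 + H * T * (H * T)ᴴ : Matrix m m ℂ) i i = ((1 : ℝ) : ℂ) + (lam i : ℝ) * (T * Tᴴ) i i := by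
      have : H * T * (H * T)ᴴ = H * (T * Tᴴ) * H := by
        rw [Matrix.conjTranspose_mul, hHH]
        simp only [Matrix.mul_assoc]
      rw [this, Matrix.add_apply, Matrix.one_apply_eq, hH, Matrix.mul_diagonal,
        Matrix.diagonal_mul, mul_right_comm, ← Complex.ofReal_mul,
        Real.mul_self_sqrt (hlam i).le, Complex.ofReal_one]
    rw [hG, Matrix.mul_diagonal, Matrix.diagonal_mul, hXi, mul_right_comm, ← Complex.ofReal_mul,
      hGsq, Complex.re_ofReal_mul, Complex.add_re, Complex.ofReal_re, Complex.re_ofReal_mul]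
    have hinv : (b i)⁻¹ * (1 + lam i * a i) = 1 := inv_mul_cancel₀ (hb i).ne'
    linear_combination hinv
  have hCtr : (G * (1 + H * T * (H * T)ᴴ) * G).trace.re =
      Fintype.card m + ∑ i, lam i * (((T * Tᴴ) i i).re - a i) / b i := by
    rw [Matrix.trace, Complex.re_sum]
    simp only [Matrix.diag_apply, hCdiag, Finset.sum_add_distrib]
    simp
  have key := hC.log_det_le_trace_sub_card
  have hXpos : 0 < (1 + H * T * (H * T)ᴴ).det.re := (Complex.pos_iff.mp hX.det_pos).1
  rw [hCdet, hCtr, Real.log_mul (inv_pos.mpr (Finset.prod_pos fun i _ => hb i)).ne' hXpos.ne',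
    Real.log_inv, Real.log_prod fun i _ => (hb i).ne', hdetX] at key
  linarith

/-- Water-filling satisfies the optimality conditions of the power allocation problem. -/
theorem waterfilling_sum_le {m : Type*} [Fintype m] (lam q : m → ℝ) (hlam : ∀ i, 0 < lam i)
    (hq : ∀ i, 0 ≤ q i) {ν p : ℝ} (hν : 0 < ν) (hp : ∑ i, max 0 (1 / ν - 1 / lam i) = p)
    (hqp : ∑ i, q i ≤ p) :
    ∑ i, lam i * (q i - max 0 (1 / ν - 1 / lam i)) /
      (1 + lam i * max 0 (1 / ν - 1 / lam i)) ≤ 0 := by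
  calc ∑ i, lam i * (q i - max 0 (1 / ν - 1 / lam i)) /
        (1 + lam i * max 0 (1 / ν - 1 / lam i))
      ≤ ∑ i, ν * (q i - max 0 (1 / ν - 1 / lam i)) := by
        refine Finset.sum_le_sum fun i _ => ?_
        have hl := hlam i
        rcases le_total (1 / ν - 1 / lam i) 0 with h | h
        · rw [max_eq_left h]
          have : lam i ≤ ν := (one_div_le_one_div hν hl).mp (by linarith)
          simpa using mul_le_mul_of_nonneg_right this (hq i)
        · rw [max_eq_right h]
          have : 1 + lam i * (1 / ν - 1 / lam i) = lam i / ν := by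
            field_simp
            ring
          rw [this]
          apply le_of_eq
          field_simp
    _ = ν * (∑ i, q i - p) := by rw [← Finset.mul_sum, Finset.sum_sub_distrib, hp]
    _ ≤ 0 := mul_nonpos_of_nonneg_of_nonpos hν.le (by linarith)

/-- The log-determinant attained by a waveform whose covariance is diagonal in the eigenbasis. -/
theorem det_one_add_of_mul_conjTranspose_eq {m l : Type*} [Fintype m] [DecidableEq m] [Fintype l]
    [DecidableEq l] (lam a : m → ℝ) {U : Matrix m m ℂ} (hU : U ∈ Matrix.unitaryGroup m ℂ)
    {S : Matrix m l ℂ} (hS : S * Sᴴ = Uᴴ * Matrix.diagonal (fun i => (a i : ℂ)) * U) :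
    (1 + Sᴴ * (Uᴴ * Matrix.diagonal (fun i => (lam i : ℂ)) * U) * S).det.re =
      ∏ i, (1 + lam i * a i) := by
  have hUU : U * Uᴴ = 1 := Matrix.mem_unitaryGroup_iff.mp hU
  have hprod : U * (S * (Sᴴ * Uᴴ)) = Matrix.diagonal (fun i => (a i : ℂ)) := by
    rw [← Matrix.mul_assoc S, hS]
    calc U * (Uᴴ * Matrix.diagonal (fun i => (a i : ℂ)) * U * Uᴴ)
        = (U * Uᴴ) * Matrix.diagonal (fun i => (a i : ℂ)) * (U * Uᴴ) := by
          simp only [Matrix.mul_assoc]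
      _ = _ := by rw [hUU, Matrix.one_mul, Matrix.mul_one]
  have : (1 + Sᴴ * (Uᴴ * Matrix.diagonal (fun i => (lam i : ℂ)) * U) * S).det =
      (1 + Matrix.diagonal (fun i => (lam i : ℂ)) * Matrix.diagonal (fun i => (a i : ℂ))).det := by
    have hcomm := Matrix.det_one_add_mul_comm (Sᴴ * Uᴴ)
      (Matrix.diagonal (fun i => (lam i : ℂ)) * (U * S))
    simp only [Matrix.mul_assoc] at hcomm ⊢
    rw [hcomm, hprod]
  rw [this, Matrix.diagonal_mul_diagonal, ← Matrix.diagonal_one, Matrix.diagonal_add,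
    Matrix.det_diagonal]
  norm_cast

/-- When there are at least as many columns as rows, every diagonal covariance in a unitary basis
is realised by some matrix. -/
theorem exists_mul_conjTranspose_eq {M L : ℕ} (hLM : M ≤ L) (a : Fin M → ℝ) (ha : ∀ i, 0 ≤ a i)
    (U : Matrix (Fin M) (Fin M) ℂ) :
    ∃ S : Matrix (Fin M) (Fin L) ℂ,
      S * Sᴴ = Uᴴ * Matrix.diagonal (fun i => (a i : ℂ)) * U := by
  set D : Matrix (Fin M) (Fin M) ℂ := Matrix.diagonal fun i => (√(a i) : ℝ) with hD
  set E : Matrix (Fin M) (Fin L) ℂ :=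
    (1 : Matrix (Fin L) (Fin L) ℂ).submatrix (Fin.castLE hLM) id with hE
  have hEE : E * Eᴴ = 1 := by
    rw [hE, Matrix.conjTranspose_submatrix, Matrix.conjTranspose_one,
      ← Matrix.submatrix_mul _ _ _ _ _ Function.bijective_id, Matrix.one_mul,
      Matrix.submatrix_one _ (Fin.castLE_injective hLM)]
  have hDH : Dᴴ = D := by simp [hD, Matrix.diagonal_conjTranspose, Pi.star_def]
  have hDD : D * D = Matrix.diagonal fun i => (a i : ℂ) := by
    rw [hD, Matrix.diagonal_mul_diagonal]
    congr 1
    ext i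
    rw [← Complex.ofReal_mul, Real.mul_self_sqrt (ha i)]
  refine ⟨Uᴴ * D * E, ?_⟩
  calc Uᴴ * D * E * (Uᴴ * D * E)ᴴ = Uᴴ * (D * (E * Eᴴ) * D) * U := by
        simp only [Matrix.conjTranspose_mul, Matrix.conjTranspose_conjTranspose, hDH,
          Matrix.mul_assoc]
    _ = _ := by rw [hEE, Matrix.mul_one, hDD]

/-- At high power every channel is active, and the water level is an affine function of the
power. -/
theorem eventually_waterfilling_eq {m : Type*} [Fintype m] [Nonempty m] (lam : m → ℝ) (ν : ℝ → ℝ)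
    (hν : ∀ p > 0, 0 < ν p ∧ ∑ i, max 0 (1 / ν p - 1 / lam i) = p)
    (hlam : ∀ i, 0 < lam i) :
    ∀ᶠ p in atTop, ∀ i, 1 + lam i * max 0 (1 / ν p - 1 / lam i) =
      lam i / Fintype.card m * (p + ∑ j, 1 / lam j) := by
  have hcard : (0 : ℝ) < Fintype.card m := Nat.cast_pos.mpr Fintype.card_pos
  have hlarge : ∀ᶠ p : ℝ in atTop, ∀ i, 1 / lam i ≤ p / Fintype.card m := by
    rw [eventually_all]
    exact fun i => (tendsto_id.atTop_div_const hcard).eventually_ge_atTop _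
  filter_upwards [hlarge, eventually_gt_atTop 0] with p hp hp0 i
  obtain ⟨hνp, hsum⟩ := hν p hp0
  have hlevel : p / Fintype.card m ≤ 1 / ν p := by
    rw [div_le_iff₀ hcard]
    calc p = ∑ i, max 0 (1 / ν p - 1 / lam i) := hsum.symm
      _ ≤ ∑ _i : m, 1 / ν p := Finset.sum_le_sum fun i _ =>
          max_le (one_div_pos.mpr hνp).le (sub_le_self _ (one_div_pos.mpr (hlam i)).le)
      _ = 1 / ν p * Fintype.card m := by simp [mul_comm]
  have hmax : ∀ i, max 0 (1 / ν p - 1 / lam i) = 1 / ν p - 1 / lam i := fun i =>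
    max_eq_right (sub_nonneg.mpr ((hp i).trans hlevel))
  simp only [hmax, Finset.sum_sub_distrib, Finset.sum_const, Finset.card_univ,
    nsmul_eq_mul] at hsum
  have hw : p + ∑ j, 1 / lam j = Fintype.card m * (1 / ν p) := by linarith
  have := (hlam i).ne'
  rw [hmax, hw]
  field_simp
  ring

/-- Theorem 6: the maximal uplink sensing rate. For each sensing power budget
`p > 0`, the supremum of `(N/L) log₂ det (I_L + Sᴴ R_T S)` over `S` with
`tr (S Sᴴ) ≤ p` equals `(N/L) ∑ m log₂ (1 + λ_m a*_m(p))`, where `a*(p)` is the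
water-filling allocation with water level `ν p`; the supremum is attained by
any `S` with `S Sᴴ = U_Tᴴ diag(a*(p)) U_T`. Moreover, as `p → ∞`, the supremum
behaves like `(NM/L)(log₂ p + (1/M) ∑ m log₂ (λ_m/M))`. -/
theorem uplink_sensing_rate_max_and_high_snr
    (M N L : ℕ) (hM : 0 < M) (hN : 0 < N) (hL : 0 < L) (hLM : M ≤ L)
    (R_T : Matrix (Fin M) (Fin M) ℂ) (hRT : R_T.PosDef)
    (lam : Fin M → ℝ) (hlam : ∀ m, 0 < lam m)
    (U : Matrix (Fin M) (Fin M) ℂ) (hU : U ∈ Matrix.unitaryGroup (Fin M) ℂ)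
    (hED : R_T = Uᴴ * Matrix.diagonal (fun m => (lam m : ℂ)) * U)
    (ν : ℝ → ℝ) (hν : ∀ p > 0, 0 < ν p ∧ ∑ m, max 0 (1 / ν p - 1 / lam m) = p)
    (astar : Fin M → ℝ → ℝ)
    (hastar : ∀ m p, astar m p = max 0 (1 / ν p - 1 / lam m))
    (rate : Matrix (Fin M) (Fin L) ℂ → ℝ)
    (hrate : ∀ S, rate S = (N / L : ℝ) * Real.logb 2 ((1 + Sᴴ * R_T * S).det.re)) :
    (∀ p > 0,
      IsGreatest {r : ℝ | ∃ S : Matrix (Fin M) (Fin L) ℂ,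
          (Matrix.trace (S * Sᴴ)).re ≤ p ∧ r = rate S}
        ((N / L : ℝ) * ∑ m, Real.logb 2 (1 + lam m * astar m p)) ∧
      (∀ S : Matrix (Fin M) (Fin L) ℂ,
        S * Sᴴ = Uᴴ * Matrix.diagonal (fun m => (astar m p : ℂ)) * U →
        rate S = (N / L : ℝ) * ∑ m, Real.logb 2 (1 + lam m * astar m p))) ∧
    Tendsto (fun p : ℝ =>
        ((N / L : ℝ) * ∑ m, Real.logb 2 (1 + lam m * astar m p)) -
          (N * M / L : ℝ) *
            (Real.logb 2 p + (1 / M : ℝ) * ∑ m, Real.logb 2 (lam m / M)))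
      atTop (nhds 0) := by
  have ha : ∀ m p, 0 ≤ astar m p := fun m p => (hastar m p).symm ▸ le_max_left _ _
  have hb : ∀ m p, 0 < 1 + lam m * astar m p := fun m p => by
    have := mul_nonneg (hlam m).le (ha m p)
    linarith
  have hUU : U * Uᴴ = 1 := Matrix.mem_unitaryGroup_iff.mp hU
  have hUU' : Uᴴ * U = 1 := Matrix.mem_unitaryGroup_iff'.mp hU
  have hNL : (0 : ℝ) ≤ N / L := by positivity
  have hlogb : ∀ p, ∑ m, Real.logb 2 (1 + lam m * astar m p) =
      (∑ m, Real.log (1 + lam m * astar m p)) / Real.log 2 := fun p => by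
    simp only [Real.logb, Finset.sum_div]
  have hattain : ∀ p, ∀ S : Matrix (Fin M) (Fin L) ℂ,
      S * Sᴴ = Uᴴ * Matrix.diagonal (fun m => (astar m p : ℂ)) * U →
      rate S = (N / L : ℝ) * ∑ m, Real.logb 2 (1 + lam m * astar m p) := fun p S hS => by
    rw [hrate, hED, det_one_add_of_mul_conjTranspose_eq lam (fun m => astar m p) hU hS,
      Real.logb_prod _ _ fun m _ => (hb m p).ne']
  refine ⟨fun p hp => ⟨⟨?_, ?_⟩, hattain p⟩, ?_⟩
  · obtain ⟨S, hS⟩ := exists_mul_conjTranspose_eq hLM (fun m => astar m p) (fun m => ha m p) U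
    refine ⟨S, ?_, (hattain p S hS).symm⟩
    rw [hS, Matrix.trace_mul_comm, ← Matrix.mul_assoc, hUU, Matrix.one_mul, Matrix.trace_diagonal,
      Complex.re_sum]
    simp only [Complex.ofReal_re, hastar]
    exact (hν p hp).2.le
  · rintro r ⟨S, hS, rfl⟩
    have hdet : Sᴴ * R_T * S =
        (U * S)ᴴ * Matrix.diagonal (fun m => (lam m : ℂ)) * (U * S) := by
      rw [hED, Matrix.conjTranspose_mul]
      simp only [Matrix.mul_assoc]
    have hbound :=
      log_det_one_add_le_tangent lam (fun m => astar m p) hlam (fun m => ha m p) (U * S)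
    have hq : ∀ m, 0 ≤ (((U * S) * (U * S)ᴴ) m m).re := fun m =>
      (Complex.nonneg_iff.mp (Matrix.posSemidef_self_mul_conjTranspose (U * S)).diag_nonneg).1
    have htrace : ∑ m, (((U * S) * (U * S)ᴴ) m m).re ≤ p := by
      have : ((U * S) * (U * S)ᴴ).trace = (S * Sᴴ).trace := by
        rw [Matrix.conjTranspose_mul, Matrix.mul_assoc, Matrix.trace_mul_comm, Matrix.mul_assoc,
          Matrix.mul_assoc, hUU', Matrix.mul_one]
      rw [← this, Matrix.trace, Complex.re_sum] at hS
      exact hS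
    have hopt := waterfilling_sum_le lam _ hlam hq (hν p hp).1 (hν p hp).2 htrace
    simp only [← hastar] at hopt
    rw [hrate, hlogb, hdet, Real.logb]
    gcongr
    linarith
  · have : Nonempty (Fin M) := ⟨⟨0, hM⟩⟩
    have hM' : (0 : ℝ) < M := Nat.cast_pos.mpr hM
    set c : ℝ := ∑ j, 1 / lam j
    have hc0 : 0 ≤ c := Finset.sum_nonneg fun j _ => (one_div_pos.mpr (hlam j)).le
    have hlim : Tendsto (fun p : ℝ => (N * M / L : ℝ) * Real.logb 2 (1 + c / p)) atTop (nhds 0) := by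
      have h1 : Tendsto (fun p : ℝ => 1 + c / p) atTop (nhds 1) := by
        simpa using (tendsto_const_nhds (x := (1 : ℝ))).add (tendsto_id.const_div_atTop c)
      have h2 := (h1.log one_ne_zero).div_const (Real.log 2)
      simpa [Real.logb] using h2.const_mul (N * M / L : ℝ)
    refine hlim.congr' ?_
    filter_upwards [eventually_waterfilling_eq lam ν hν hlam, eventually_gt_atTop 0] with p hp hp0
    have hterm : ∀ m, Real.logb 2 (1 + lam m * astar m p) =
        Real.logb 2 (lam m / M) + Real.logb 2 (p + c) := fun m => by
      rw [hastar, hp m, Fintype.card_fin,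
        Real.logb_mul (div_pos (hlam m) hM').ne' (by positivity)]
    have hratio : Real.logb 2 (1 + c / p) = Real.logb 2 (p + c) - Real.logb 2 p := by
      rw [← Real.logb_div (by positivity) hp0.ne', add_div, div_self hp0.ne']
    simp only [hterm, Finset.sum_add_distrib, Finset.sum_const, Finset.card_univ, Fintype.card_fin,
      nsmul_eq_mul, hratio]
    field_simp
    ring
end

section
/- Let N ≥ K ≥ 1 and let H ∈ ℂ^{N×K} be a matrix of full column rank (equivalently, Hᴴ H is invertible). Then det(I_N + p H Hᴴ) and det(Hᴴ H) are positive real numbers for every p > 0, and lim_{p→∞} [ log₂ det(I_N + p H Hᴴ) − K log₂ p ] = log₂ det(Hᴴ H). -/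
open Matrix Filter

/-- The normalized form of `det (I + p H Hᴴ)`, obtained from the Weinstein–Aronszajn identity. -/
theorem det_one_add_smul_mul_conjTranspose_eq {m n : Type*} [Fintype m] [DecidableEq m]
    [Fintype n] [DecidableEq n] (H : Matrix m n ℂ) {c : ℂ} (hc : c ≠ 0) :
    (1 + c • (H * Hᴴ)).det = c ^ Fintype.card n * (c⁻¹ • (1 : Matrix n n ℂ) + Hᴴ * H).det := by
  rw [← Matrix.smul_mul, det_one_add_mul_comm, Matrix.mul_smul, ← det_smul, smul_add, smul_smul,
    mul_inv_cancel₀ hc, one_smul]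

open scoped ComplexOrder in
/-- The determinant of a complex positive definite matrix is a positive real number. -/
theorem det_im_eq_zero_and_re_pos_of_posDef {n : Type*} [Fintype n] [DecidableEq n]
    {A : Matrix n n ℂ} (hA : A.PosDef) : A.det.im = 0 ∧ 0 < A.det.re :=
  ⟨(Complex.pos_iff.mp hA.det_pos).2.symm, (Complex.pos_iff.mp hA.det_pos).1⟩

open scoped ComplexOrder in
/-- An invertible Gram matrix has a positive real determinant. -/
theorem det_conjTranspose_mul_self_im_eq_zero_and_re_pos {m n : Type*} [Fintype m] [Fintype n]
    [DecidableEq n] (H : Matrix m n ℂ) (hH : IsUnit (Hᴴ * H)) :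
    (Hᴴ * H).det.im = 0 ∧ 0 < (Hᴴ * H).det.re :=
  det_im_eq_zero_and_re_pos_of_posDef
    ((posSemidef_conjTranspose_mul_self H).posDef_iff_isUnit.mpr hH)

open scoped ComplexOrder in
/-- For `p ≥ 0`, the determinant of `I + p H Hᴴ` is a positive real number. -/
theorem det_one_add_smul_mul_conjTranspose_im_eq_zero_and_re_pos {m n : Type*} [Fintype m]
    [DecidableEq m] [Fintype n] (H : Matrix m n ℂ) {p : ℝ} (hp : 0 ≤ p) :
    (1 + (p : ℂ) • (H * Hᴴ)).det.im = 0 ∧ 0 < (1 + (p : ℂ) • (H * Hᴴ)).det.re :=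
  det_im_eq_zero_and_re_pos_of_posDef <| PosDef.one.add_posSemidef <|
    (posSemidef_self_mul_conjTranspose H).smul (Complex.zero_le_real.mpr hp)

/-- Deterministic high-SNR expansion of the MIMO log-determinant capacity:
for a full-column-rank `H ∈ ℂ^{N×K}` (i.e. `Hᴴ H` invertible), the
determinants `det (I_N + p H Hᴴ)` and `det (Hᴴ H)` are positive reals for every
`p > 0`, and `log₂ det (I_N + p H Hᴴ) − K log₂ p → log₂ det (Hᴴ H)` as
`p → ∞`. -/
theorem mimo_logdet_high_snr
    (N K : ℕ) (hK : 1 ≤ K) (hNK : K ≤ N)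
    (H : Matrix (Fin N) (Fin K) ℂ) (hH : IsUnit (Hᴴ * H)) :
    (∀ p : ℝ, 0 < p →
      ((1 + (p : ℂ) • (H * Hᴴ)).det.im = 0 ∧ 0 < (1 + (p : ℂ) • (H * Hᴴ)).det.re)) ∧
    ((Hᴴ * H).det.im = 0 ∧ 0 < (Hᴴ * H).det.re) ∧
    Tendsto (fun p : ℝ =>
        Real.logb 2 ((1 + (p : ℂ) • (H * Hᴴ)).det.re) - K * Real.logb 2 p)
      atTop (nhds (Real.logb 2 ((Hᴴ * H).det.re))) := by
  have hdet := det_conjTranspose_mul_self_im_eq_zero_and_re_pos H hH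
  refine ⟨fun p hp => det_one_add_smul_mul_conjTranspose_im_eq_zero_and_re_pos H hp.le, hdet, ?_⟩
  have hcont : Continuous fun t : ℝ =>
      ((t : ℂ) • (1 : Matrix (Fin K) (Fin K) ℂ) + Hᴴ * H).det.re := by
    fun_prop
  have hlim : Tendsto (fun p : ℝ =>
      (((p⁻¹ : ℝ) : ℂ) • (1 : Matrix (Fin K) (Fin K) ℂ) + Hᴴ * H).det.re)
      atTop (nhds (Hᴴ * H).det.re) := by
    simpa only [Function.comp_def, Complex.ofReal_zero, zero_smul, zero_add] using
      (hcont.tendsto 0).comp tendsto_inv_atTop_zero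
  refine (hlim.logb hdet.2.ne').congr' ?_
  filter_upwards [eventually_gt_atTop 0] with p hp
  have hre : (1 + (p : ℂ) • (H * Hᴴ)).det.re =
      p ^ K * (((p⁻¹ : ℝ) : ℂ) • (1 : Matrix (Fin K) (Fin K) ℂ) + Hᴴ * H).det.re := by
    rw [det_one_add_smul_mul_conjTranspose_eq H (Complex.ofReal_ne_zero.mpr hp.ne'),
      Fintype.card_fin, ← Complex.ofReal_pow, Complex.re_ofReal_mul, Complex.ofReal_inv]
  have hne := right_ne_zero_of_mul
    (hre ▸ (det_one_add_smul_mul_conjTranspose_im_eq_zero_and_re_pos H hp.le).2.ne')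
  rw [hre, Real.logb_mul (pow_ne_zero K hp.ne') hne, Real.logb_pow, add_sub_cancel_left]
end

section
/- Let M ≥ K ≥ 1 and let h_1, …, h_K ∈ ℂ^M be vectors such that the matrix H = [h_1 ⋯ h_K] ∈ ℂ^{M×K} has full column rank. For p > 0 define R(p) = sup { log₂ det( I_M + ∑_{k=1}^{K} q_k h_k h_kᴴ ) : q_1,…,q_K ≥ 0, ∑_{k=1}^{K} q_k ≤ p }. Then lim_{p→∞} [ R(p) − K log₂(p/K) ] = log₂ det(Hᴴ H). -/
open Matrix Filter

open scoped ComplexOrder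

lemma Matrix.PosSemidef.det_re_le_trace_div_card_pow {n : Type*} [Fintype n] [DecidableEq n]
    [Nonempty n] {A : Matrix n n ℂ} (hA : A.PosSemidef) :
    A.det.re ≤ (A.trace.re / Fintype.card n) ^ Fintype.card n := by
  have hdet : A.det.re = ∏ i, hA.1.eigenvalues i := by
    rw [hA.1.det_eq_prod_eigenvalues]
    simp only [Complex.coe_algebraMap, ← Complex.ofReal_prod, Complex.ofReal_re]
  have htr : A.trace.re = ∑ i, hA.1.eigenvalues i := by
    rw [hA.1.trace_eq_sum_eigenvalues]
    simp
  have hcard : Fintype.card n ≠ 0 := Fintype.card_ne_zero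
  have hamgm := Real.geom_mean_le_arith_mean Finset.univ (fun _ : n => (1 : ℝ))
    hA.1.eigenvalues (fun _ _ => zero_le_one) (by simp [Fintype.card_pos])
    (fun i _ => hA.eigenvalues_nonneg i)
  have hnonneg : 0 ≤ ∏ i, hA.1.eigenvalues i :=
    Finset.prod_nonneg fun i _ => hA.eigenvalues_nonneg i
  simp only [Real.rpow_one, one_mul, Finset.sum_const, Finset.card_univ, nsmul_eq_mul,
    mul_one] at hamgm
  rw [hdet, htr]
  calc _ = ((∏ i, hA.1.eigenvalues i) ^ ((Fintype.card n : ℝ)⁻¹)) ^ Fintype.card n :=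
        (Real.rpow_inv_natCast_pow hnonneg hcard).symm
    _ ≤ _ := pow_le_pow_left₀ (Real.rpow_nonneg hnonneg _) hamgm _

/-- The Weinstein–Aronszajn form of the determinant in the sum rate. -/
lemma det_one_add_sum_smul_vecMulVec {m n : Type*} [Fintype m] [DecidableEq m] [Fintype n]
    [DecidableEq n] (h : n → m → ℂ) (H : Matrix m n ℂ) (hH : ∀ i k, H i k = h k i)
    (q : n → ℂ) :
    (1 + ∑ k, q k • vecMulVec (h k) (fun i => star (h k i))).det
      = (1 + diagonal q * (Hᴴ * H)).det := by
  have hsum : ∑ k, q k • vecMulVec (h k) (fun i => star (h k i)) = H * (diagonal q * Hᴴ) := by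
    ext i j
    rw [Matrix.sum_apply, Matrix.mul_apply]
    refine Finset.sum_congr rfl fun k _ => ?_
    simp [vecMulVec_apply, diagonal_mul, hH]
    ring
  rw [hsum, det_one_add_mul_comm, Matrix.mul_assoc]

lemma det_one_add_diagonal_mul_eq_mul_det {n : Type*} [Fintype n] [DecidableEq n]
    {G : Matrix n n ℂ} (hG : IsUnit G) (q : n → ℂ) :
    (1 + diagonal q * G).det = (diagonal q + G⁻¹).det * G.det := by
  rw [← det_mul, Matrix.add_mul, nonsing_inv_mul _ ((isUnit_iff_isUnit_det G).1 hG), add_comm]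

lemma Matrix.PosDef.det_one_add_diagonal_mul_re_pos {n : Type*} [Fintype n] [DecidableEq n]
    {G : Matrix n n ℂ} (hG : G.PosDef) {q : n → ℝ} (hq : ∀ k, 0 ≤ q k) :
    0 < (1 + diagonal (fun k => (q k : ℂ)) * G).det.re := by
  have hD : (diagonal fun k => (q k : ℂ)).PosSemidef :=
    PosSemidef.diagonal fun k => by simpa using hq k
  rw [det_one_add_diagonal_mul_eq_mul_det hG.isUnit]
  exact (Complex.pos_iff.1 (mul_pos (PosDef.posSemidef_add hD hG.inv).det_pos hG.det_pos)).1

lemma Matrix.PosDef.det_one_add_diagonal_mul_re_le {n : Type*} [Fintype n] [DecidableEq n]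
    [Nonempty n] {G : Matrix n n ℂ} (hG : G.PosDef) {q : n → ℝ} (hq : ∀ k, 0 ≤ q k) {p : ℝ}
    (hp : ∑ k, q k ≤ p) :
    (1 + diagonal (fun k => (q k : ℂ)) * G).det.re
      ≤ ((p + G⁻¹.trace.re) / Fintype.card n) ^ Fintype.card n * G.det.re := by
  have hD : (diagonal fun k => (q k : ℂ)).PosSemidef :=
    PosSemidef.diagonal fun k => by simpa using hq k
  have hGdet := Complex.pos_iff.1 hG.det_pos
  have htr : (diagonal (fun k => (q k : ℂ)) + G⁻¹).trace.re = ∑ k, q k + G⁻¹.trace.re := by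
    simp [trace_add, trace_diagonal]
  have htr0 : 0 ≤ G⁻¹.trace.re := (Complex.nonneg_iff.1 hG.inv.posSemidef.trace_nonneg).1
  have hq0 : 0 ≤ ∑ k, q k := Finset.sum_nonneg fun k _ => hq k
  rw [det_one_add_diagonal_mul_eq_mul_det hG.isUnit, Complex.mul_re, ← hGdet.2, mul_zero,
    sub_zero]
  refine mul_le_mul_of_nonneg_right ?_ hGdet.1.le
  refine (hD.add hG.inv.posSemidef).det_re_le_trace_div_card_pow.trans ?_
  rw [htr]
  gcongr

lemma det_one_add_diagonal_const_mul_re {n : Type*} [Fintype n] [DecidableEq n]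
    (G : Matrix n n ℂ) {t : ℝ} (ht : t ≠ 0) :
    (1 + diagonal (fun _ => (t : ℂ)) * G).det.re
      = t ^ Fintype.card n * (((t⁻¹ : ℝ) : ℂ) • (1 : Matrix n n ℂ) + G).det.re := by
  have ht' : (t : ℂ) ≠ 0 := by exact_mod_cast ht
  have hfac : 1 + diagonal (fun _ => (t : ℂ)) * G
      = (t : ℂ) • (((t⁻¹ : ℝ) : ℂ) • (1 : Matrix n n ℂ) + G) := by
    rw [← smul_one_eq_diagonal, smul_add, smul_smul, Complex.ofReal_inv, mul_inv_cancel₀ ht']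
    simp
  rw [hfac, det_smul, ← Complex.ofReal_pow, Complex.re_ofReal_mul]

/-- High-SNR expansion of the maximal downlink sum communication rate (dirty
paper coding, via uplink–downlink duality): for fixed channel vectors
`h_1,…,h_K ∈ ℂ^M` whose concatenation `H` has full column rank,
`R p = sup { log₂ det (I_M + ∑ k q_k h_k h_kᴴ) : q ≥ 0, ∑ q_k ≤ p }`
satisfies `R p − K log₂ (p/K) → log₂ det (Hᴴ H)` as `p → ∞`. -/
theorem downlink_sum_rate_high_snr
    (M K : ℕ) (hK : 1 ≤ K) (hKM : K ≤ M)
    (h : Fin K → Fin M → ℂ)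
    (H : Matrix (Fin M) (Fin K) ℂ) (hHdef : ∀ i k, H i k = h k i)
    (hH : IsUnit (Hᴴ * H))
    (R : ℝ → ℝ)
    (hR : ∀ p, R p = sSup {r : ℝ | ∃ q : Fin K → ℝ,
        (∀ k, 0 ≤ q k) ∧ (∑ k, q k) ≤ p ∧
        r = Real.logb 2
          ((1 + ∑ k, (q k : ℂ) •
            Matrix.vecMulVec (h k) (fun i => star (h k i))).det.re)}) :
    Tendsto (fun p : ℝ => R p - K * Real.logb 2 (p / K))
      atTop (nhds (Real.logb 2 ((Hᴴ * H).det.re))) := by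
  have : Nonempty (Fin K) := ⟨⟨0, hK⟩⟩
  have hK0 : (0 : ℝ) < K := by exact_mod_cast hK
  set G := Hᴴ * H with hGdef
  have hG : G.PosDef := (posSemidef_conjTranspose_mul_self H).posDef_iff_isUnit.2 hH
  have hGdet : 0 < G.det.re := (Complex.pos_iff.1 hG.det_pos).1
  have hGtr : 0 ≤ G⁻¹.trace.re := (Complex.nonneg_iff.1 hG.inv.posSemidef.trace_nonneg).1
  simp only [det_one_add_sum_smul_vecMulVec h H hHdef, ← hGdef] at hR
  set c := G⁻¹.trace.re / K with hc
  have hupper (p : ℝ) (hp : 0 < p) (q : Fin K → ℝ) (hq : ∀ k, 0 ≤ q k) (hqp : ∑ k, q k ≤ p) :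
      Real.logb 2 (1 + diagonal (fun k => (q k : ℂ)) * G).det.re
        ≤ K * Real.logb 2 (p / K + c) + Real.logb 2 G.det.re := by
    have hpc : 0 < p / K + c := by positivity
    have hle := hG.det_one_add_diagonal_mul_re_le hq hqp
    rw [Fintype.card_fin, add_div] at hle
    refine (Real.logb_le_logb_of_le one_lt_two
      (hG.det_one_add_diagonal_mul_re_pos hq) hle).trans_eq ?_
    rw [Real.logb_mul (by positivity) hGdet.ne', Real.logb_pow]
  have hcont : Tendsto (fun p : ℝ =>
      Real.logb 2 ((((p / K)⁻¹ : ℝ) : ℂ) • (1 : Matrix (Fin K) (Fin K) ℂ) + G).det.re)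
      atTop (nhds (Real.logb 2 G.det.re)) := by
    have hcts : Continuous fun s : ℝ =>
        ((s : ℂ) • (1 : Matrix (Fin K) (Fin K) ℂ) + G).det.re := by fun_prop
    have hs : Tendsto (fun p : ℝ => (p / K)⁻¹) atTop (nhds 0) :=
      (tendsto_id.atTop_div_const hK0).inv_tendsto_atTop
    have hdet := (hcts.tendsto 0).comp hs
    simp only [Complex.ofReal_zero, zero_smul, zero_add] at hdet
    exact (Real.continuousAt_logb hGdet.ne').tendsto.comp hdet
  have hlim : Tendsto (fun p : ℝ => K * Real.logb 2 (1 + c / (p / K)) + Real.logb 2 G.det.re)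
      atTop (nhds (Real.logb 2 G.det.re)) := by
    have hs : Tendsto (fun p : ℝ => 1 + c / (p / K)) atTop (nhds 1) := by
      simpa using (tendsto_const_nhds (x := (1 : ℝ))).add
        ((tendsto_id.atTop_div_const hK0).const_div_atTop c)
    have hl := ((Real.continuousAt_logb (b := 2) one_ne_zero).tendsto.comp hs).const_mul (K : ℝ)
    simpa using hl.add_const (Real.logb 2 G.det.re)
  refine tendsto_of_tendsto_of_tendsto_of_le_of_le' hcont hlim ?_ ?_
  · filter_upwards [eventually_gt_atTop 0] with p hp
    have ht : 0 < p / K := by positivity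
    have hpos := hG.det_one_add_diagonal_mul_re_pos (q := fun _ => p / K) fun _ => ht.le
    have hfac := det_one_add_diagonal_const_mul_re G ht.ne'
    rw [Fintype.card_fin] at hfac
    have hne := right_ne_zero_of_mul (hfac ▸ hpos.ne')
    rw [le_sub_iff_add_le', ← Real.logb_pow, ← Real.logb_mul (by positivity) hne, ← hfac, hR]
    refine le_csSup ⟨K * Real.logb 2 (p / K + c) + Real.logb 2 G.det.re, ?_⟩
      ⟨fun _ => p / K, fun _ => ht.le, ?_, rfl⟩
    · rintro r ⟨q, hq, hqp, rfl⟩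
      exact hupper p hp q hq hqp
    · simp [mul_div_cancel₀ p hK0.ne']
  · filter_upwards [eventually_gt_atTop 0] with p hp
    have ht : 0 < p / K := by positivity
    have hfactor : p / K + c = p / K * (1 + c / (p / K)) := by field_simp
    have hpc : 0 < 1 + c / (p / K) := by positivity
    rw [sub_le_iff_le_add, hR]
    refine csSup_le ⟨_, 0, fun _ => le_rfl, by simpa using hp.le, rfl⟩ ?_
    rintro r ⟨q, hq, hqp, rfl⟩
    refine (hupper p hp q hq hqp).trans_eq ?_
    rw [hfactor, Real.logb_mul ht.ne' hpc.ne']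
    ring
end

section
/- Let M, N, L be positive integers with L ≥ M, let R_T be an M×M Hermitian positive definite complex matrix, and let α ∈ [0, 1). For p > 0 define the FDSAC sensing rate R^α(p) = ((1−α) N / L) · sup { log₂ det( I_L + (1/(1−α)) Sᴴ R_T S ) : S ∈ ℂ^{M×L}, tr(S Sᴴ) ≤ p }. Then lim_{p→∞} R^α(p) / log₂ p = (1−α) N M / L. -/
open Matrix Real ComplexOrder Filter

/-- If `f` grows like a positive multiple of `p ^ n`, then `log f p / log p` tends to `n`. -/
theorem tendsto_logb_div_logb_of_tendsto_div_pow {b : ℝ} (hb : 1 < b) {f : ℝ → ℝ} {n : ℕ} {C : ℝ}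
    (hC : 0 < C) (hf : Tendsto (fun p => f p / p ^ n) atTop (nhds C)) :
    Tendsto (fun p => Real.logb b (f p) / Real.logb b p) atTop (nhds n) := by
  have hlog := (hf.logb (b := b) hC.ne').div_atTop (Real.tendsto_logb_atTop hb)
  have hlim := hlog.add_const (n : ℝ)
  rw [zero_add] at hlim
  refine hlim.congr' ?_
  filter_upwards [hf.eventually (lt_mem_nhds hC), eventually_gt_atTop 1] with p hp hp1
  have hpn : (0 : ℝ) < p ^ n := by positivity
  have hfp : f p ≠ 0 := fun h => by simp [h] at hp
  have hlp : Real.logb b p ≠ 0 := (Real.logb_pos hb hp1).ne'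
  rw [Real.logb_div hfp hpn.ne', Real.logb_pow]
  field_simp
  ring

/-- Upper bounds at least `1` on the absolute value give upper bounds on the logarithm. -/
theorem logb_le_logb_of_abs_le {b x y : ℝ} (hb : 1 < b) (hy : 1 ≤ y) (hxy : |x| ≤ y) :
    Real.logb b x ≤ Real.logb b y := by
  rcases eq_or_ne x 0 with rfl | hx
  · simpa using Real.logb_nonneg hb hy
  · rw [← Real.logb_abs]
    exact Real.logb_le_logb_of_le hb (abs_pos.mpr hx) hxy

/-- An isotropic waveform: `S Sᴴ` can be any nonnegative multiple of the identity. -/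
theorem exists_mul_conjTranspose_eq_smul_one {m n : Type*} [DecidableEq m] [Fintype n]
    [DecidableEq n] (e : m ↪ n) {t : ℝ} (ht : 0 ≤ t) :
    ∃ S : Matrix m n ℂ, S * Sᴴ = (t : ℂ) • (1 : Matrix m m ℂ) := by
  refine ⟨(√t : ℂ) • (1 : Matrix n n ℂ).submatrix e id, ?_⟩
  rw [Matrix.conjTranspose_smul, Matrix.conjTranspose_submatrix, Matrix.conjTranspose_one,
    Matrix.smul_mul, Matrix.mul_smul, smul_smul,
    ← Matrix.submatrix_mul _ _ _ _ _ Function.bijective_id, Matrix.mul_one,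
    Matrix.submatrix_one _ e.injective, Complex.star_def, Complex.conj_ofReal,
    ← Complex.ofReal_mul, Real.mul_self_sqrt ht]

section

variable {m n : Type*} [Fintype m] [Fintype n]

theorem trace_mul_conjTranspose_re (S : Matrix m n ℂ) :
    (S * Sᴴ).trace.re = ∑ i, ∑ j, ‖S i j‖ ^ 2 := by
  simp only [Matrix.trace, Matrix.diag, Matrix.mul_apply, Matrix.conjTranspose_apply,
    Complex.re_sum]
  refine Finset.sum_congr rfl fun i _ => Finset.sum_congr rfl fun j _ => ?_
  rw [← Complex.normSq_eq_norm_sq, Complex.star_def, Complex.mul_conj, Complex.ofReal_re]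

theorem norm_mul_conjTranspose_apply_le {S : Matrix m n ℂ} {p : ℝ}
    (hS : (S * Sᴴ).trace.re ≤ p) (i k : m) :
    ‖(S * Sᴴ) i k‖ ≤ Fintype.card n * p := by
  have hsq : ∀ i j, ‖S i j‖ ^ 2 ≤ p := fun i j => by
    rw [trace_mul_conjTranspose_re] at hS
    calc ‖S i j‖ ^ 2 ≤ ∑ j, ‖S i j‖ ^ 2 :=
          Finset.single_le_sum (f := fun j => ‖S i j‖ ^ 2)
            (fun _ _ => by positivity) (Finset.mem_univ j)
      _ ≤ ∑ i, ∑ j, ‖S i j‖ ^ 2 :=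
          Finset.single_le_sum (f := fun i => ∑ j, ‖S i j‖ ^ 2)
            (fun _ _ => by positivity) (Finset.mem_univ i)
      _ ≤ p := hS
  rw [Matrix.mul_apply, ← nsmul_eq_mul, ← Finset.card_univ]
  refine norm_sum_le_of_le _ (fun j _ => ?_) |>.trans (Finset.sum_const p).le
  rw [Matrix.conjTranspose_apply, norm_mul, norm_star]
  nlinarith [hsq i j, hsq k j, sq_nonneg (‖S i j‖ - ‖S k j‖)]

variable [DecidableEq m] [DecidableEq n]

theorem det_one_add_smul_conjTranspose_mul_mul (c : ℂ) (R : Matrix m m ℂ) (S : Matrix m n ℂ) :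
    (1 + c • (Sᴴ * R * S)).det = (1 + c • (R * (S * Sᴴ))).det := by
  rw [Matrix.mul_assoc, ← Matrix.mul_smul, Matrix.det_one_add_mul_comm, Matrix.smul_mul,
    Matrix.mul_assoc]

/-- Under a power constraint `tr (S Sᴴ) ≤ p`, the determinant grows at most like `p ^ card m`. -/
theorem exists_norm_det_one_add_smul_le (c : ℂ) (R : Matrix m m ℂ) :
    ∃ K : ℝ, 0 < K ∧ ∀ (S : Matrix m n ℂ) (p : ℝ), 0 ≤ p → (S * Sᴴ).trace.re ≤ p →
      ‖(1 + c • (Sᴴ * R * S)).det‖ ≤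
        (Fintype.card m).factorial * (1 + K * p) ^ Fintype.card m := by
  set B : ℝ := ∑ i, ∑ j, ‖R i j‖
  have hB : 0 ≤ B := by positivity
  refine ⟨‖c‖ * (B * Fintype.card n) + 1, by positivity, fun S p hp hS => ?_⟩
  rw [det_one_add_smul_conjTranspose_mul_mul, ← nsmul_eq_mul]
  refine Matrix.det_le (abv := NormedField.toAbsoluteValue ℂ) fun i k => ?_
  change ‖(1 + c • (R * (S * Sᴴ)) : Matrix m m ℂ) i k‖ ≤ _
  have hone : ‖(1 : Matrix m m ℂ) i k‖ ≤ 1 := by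
    rw [Matrix.one_apply]; split_ifs <;> simp
  have hmul : ‖(R * (S * Sᴴ)) i k‖ ≤ B * (Fintype.card n * p) := by
    rw [Matrix.mul_apply]
    calc ‖∑ j, R i j * (S * Sᴴ) j k‖ ≤ ∑ j, ‖R i j‖ * (Fintype.card n * p) :=
          norm_sum_le_of_le _ fun j _ => by
            rw [norm_mul]
            exact mul_le_mul_of_nonneg_left (norm_mul_conjTranspose_apply_le hS j k) (norm_nonneg _)
      _ = (∑ j, ‖R i j‖) * (Fintype.card n * p) := (Finset.sum_mul _ _ _).symm
      _ ≤ B * (Fintype.card n * p) := by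
          gcongr
          exact Finset.single_le_sum (f := fun i => ∑ j, ‖R i j‖)
            (fun _ _ => by positivity) (Finset.mem_univ i)
  calc ‖(1 + c • (R * (S * Sᴴ)) : Matrix m m ℂ) i k‖ ≤ 1 + ‖c‖ * (B * (Fintype.card n * p)) := by
        rw [Matrix.add_apply, Matrix.smul_apply, smul_eq_mul]
        refine (norm_add_le _ _).trans (add_le_add hone ?_)
        rw [norm_mul]
        gcongr
    _ ≤ _ := by nlinarith

theorem tendsto_det_one_add_smul_re_div_pow (R : Matrix m m ℂ) :
    Tendsto (fun p : ℝ => (1 + (p : ℂ) • R).det.re / p ^ Fintype.card m) atTop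
      (nhds R.det.re) := by
  have hcont : Continuous fun x : ℝ => ((x : ℂ) • (1 : Matrix m m ℂ) + R).det.re := by
    fun_prop
  have hlim := (hcont.tendsto 0).comp tendsto_inv_atTop_zero
  simp only [Complex.ofReal_zero, zero_smul, zero_add] at hlim
  refine hlim.congr' ?_
  filter_upwards [eventually_gt_atTop 0] with p hp
  have hpc : (p : ℂ) ≠ 0 := by exact_mod_cast hp.ne'
  have hfac : 1 + (p : ℂ) • R = (p : ℂ) • (((p⁻¹ : ℝ) : ℂ) • (1 : Matrix m m ℂ) + R) := by
    rw [smul_add, smul_smul, Complex.ofReal_inv, mul_inv_cancel₀ hpc, one_smul]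
  rw [hfac, Matrix.det_smul, ← Complex.ofReal_pow, Complex.re_ofReal_mul]
  simp only [Function.comp_apply]
  field_simp

end

/-- Degrees-of-freedom of FDSAC sensing (Sections III-C and IV-C): when a
fraction `1−α` of the bandwidth is allocated to sensing, the maximal FDSAC
sensing rate
`R^α(p) = ((1−α)N/L) · sup {log₂ det (I_L + (1/(1−α)) Sᴴ R_T S) : tr(S Sᴴ) ≤ p}`
has high-SNR slope `(1−α)NM/L`, i.e. `R^α(p)/log₂ p → (1−α)NM/L`. -/
theorem fdsac_sensing_rate_high_snr_slope
    (M N L : ℕ) (hM : 0 < M) (hN : 0 < N) (hL : 0 < L) (hLM : M ≤ L)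
    (R_T : Matrix (Fin M) (Fin M) ℂ) (hRT : R_T.PosDef)
    (α : ℝ) (hα : 0 ≤ α) (hα1 : α < 1)
    (Rα : ℝ → ℝ)
    (hRα : ∀ p, Rα p = ((1 - α) * N / L : ℝ) *
      sSup {r : ℝ | ∃ S : Matrix (Fin M) (Fin L) ℂ,
        (Matrix.trace (S * Sᴴ)).re ≤ p ∧
        r = Real.logb 2
          ((1 + (((1 - α)⁻¹ : ℝ) : ℂ) • (Sᴴ * R_T * S)).det.re)}) :
    Tendsto (fun p : ℝ => Rα p / Real.logb 2 p) atTop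
      (nhds ((1 - α) * N * M / L : ℝ)) := by
  set c : ℝ := (1 - α)⁻¹
  have hc : 0 < c := inv_pos.mpr (sub_pos.mpr hα1)
  have hM' : (0 : ℝ) < M := by exact_mod_cast hM
  obtain ⟨K, hK, hdet⟩ := exists_norm_det_one_add_smul_le (n := Fin L) (c : ℂ) R_T
  simp only [Fintype.card_fin] at hdet
  set rates : ℝ → Set ℝ := fun p => {r : ℝ | ∃ S : Matrix (Fin M) (Fin L) ℂ,
    (Matrix.trace (S * Sᴴ)).re ≤ p ∧
    r = Real.logb 2 ((1 + (c : ℂ) • (Sᴴ * R_T * S)).det.re)}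
  set Q : Matrix (Fin M) (Fin M) ℂ := ((c / M : ℝ) : ℂ) • R_T with hQ
  have hQdet : 0 < Q.det.re := by
    have hcM : (0 : ℂ) < ((c / M : ℝ) : ℂ) := by exact_mod_cast div_pos hc hM'
    exact (Complex.pos_iff.mp (hRT.smul hcM).det_pos).1
  have hlower : ∀ p, 0 ≤ p → Real.logb 2 ((1 + (p : ℂ) • Q).det.re) ∈ rates p := fun p hp => by
    obtain ⟨S, hS⟩ := exists_mul_conjTranspose_eq_smul_one
      (Fin.castLEEmb hLM) (div_nonneg hp hM'.le)
    refine ⟨S, ?_, ?_⟩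
    · rw [hS, Matrix.trace_smul, Matrix.trace_one, Fintype.card_fin, smul_eq_mul,
        Complex.re_ofReal_mul, Complex.natCast_re, div_mul_cancel₀ _ hM'.ne']
    · rw [det_one_add_smul_conjTranspose_mul_mul, hS, Matrix.mul_smul, Matrix.mul_one, hQ,
        smul_smul, smul_smul, ← Complex.ofReal_mul, ← Complex.ofReal_mul,
        show p * (c / M) = c * (p / M) by ring]
  have hupper : ∀ p, 0 ≤ p → ∀ r ∈ rates p,
      r ≤ Real.logb 2 (M.factorial * (1 + K * p) ^ M) := by
    rintro p hp r ⟨S, hS, rfl⟩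
    refine logb_le_logb_of_abs_le one_lt_two ?_
      ((Complex.abs_re_le_norm _).trans (hdet S p hp hS))
    exact one_le_mul_of_one_le_of_one_le (by exact_mod_cast M.factorial_pos)
      (one_le_pow₀ (le_add_of_nonneg_right (by positivity)))
  have hlim_lower := tendsto_logb_div_logb_of_tendsto_div_pow one_lt_two hQdet
    (tendsto_det_one_add_smul_re_div_pow Q)
  have hlim_upper : Tendsto
      (fun p : ℝ => Real.logb 2 (M.factorial * (1 + K * p) ^ M) / Real.logb 2 p)
      atTop (nhds M) := by
    refine tendsto_logb_div_logb_of_tendsto_div_pow one_lt_two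
      (C := M.factorial * (0 + K) ^ M) (by positivity) ?_
    refine (((tendsto_inv_atTop_zero.add_const K).pow M).const_mul (M.factorial : ℝ)).congr' ?_
    filter_upwards [eventually_gt_atTop 0] with p hp
    rw [mul_div_assoc, ← div_pow, add_div, mul_div_cancel_right₀ _ hp.ne', one_div]
  rw [Fintype.card_fin] at hlim_lower
  have hslope : Tendsto (fun p => sSup (rates p) / Real.logb 2 p) atTop (nhds M) := by
    refine tendsto_of_tendsto_of_tendsto_of_le_of_le' hlim_lower hlim_upper ?_ ?_
    all_goals
      filter_upwards [eventually_gt_atTop 1] with p hp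
      have hp0 : 0 ≤ p := by linarith
      refine div_le_div_of_nonneg_right ?_ (Real.logb_pos one_lt_two hp).le
    · exact le_csSup ⟨_, hupper p hp0⟩ (hlower p hp0)
    · exact csSup_le ⟨_, hlower p hp0⟩ (hupper p hp0)
  have hlim := hslope.const_mul ((1 - α) * N / L : ℝ)
  rw [div_mul_eq_mul_div] at hlim
  refine hlim.congr fun p => ?_
  rw [hRα p]
  exact (mul_div_assoc _ _ _).symm
end
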